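/- Let α>0 with α≠1, s<0, t>0. Then the convex hull of A_{α,s,t} in ℝ² equals all of ℝ², and consequently every bounded holomorphic function on the tube domain T_{A_{α,s,t}} is constant. -/

import Mathlib

open Complex Metric Set Filter Topology

/-- The tube domain over a base `D ⊆ ℝ²`. -/
def tube (D : Set (ℝ × ℝ)) : Set (ℂ × ℂ) := {z | (z.1.re, z.2.re) ∈ D}

/-- The base domain `A_{α,s,t}`: `x₂ > t·x₁^α` for `x₁ > 0`, `x₂ > 0` for `x₁ = 0`,
and `x₂ > s·(-x₁)^α` for `x₁ < 0`. -/
def setA (α s t : ℝ) : Set (ℝ × ℝ) :=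
  {x | (0 < x.1 → t * x.1 ^ α < x.2) ∧ (x.1 = 0 → 0 < x.2) ∧
       (x.1 < 0 → s * (-x.1) ^ α < x.2)}

theorem halfPlane_isOpen (a : ℝ) : IsOpen {w : ℂ | a < w.re} :=
  isOpen_lt continuous_const Complex.continuous_re

/-- Holomorphic dependence of an integral on a parameter in a half plane. -/
theorem avg_diff (G : ℂ → ℝ → ℂ) (C : ℝ)
    (hc : ∀ c : ℂ, 0 < c.re → Continuous (G c))
    (hd : ∀ θ : ℝ, DifferentiableOn ℂ (fun c => G c θ) {c : ℂ | 0 < c.re})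
    (hb : ∀ c : ℂ, 0 < c.re → ∀ θ, ‖G c θ‖ ≤ C) :
    DifferentiableOn ℂ (fun c => ∫ θ in (0:ℝ)..(2 * Real.pi), G c θ) {c : ℂ | 0 < c.re} := by
  intro c₀ hc₀
  have hc₀' : 0 < c₀.re := hc₀
  have hO := halfPlane_isOpen 0
  set ρ : ℝ := c₀.re / 2 with hρ
  have hρ0 : 0 < ρ := by positivity
  have hre : ∀ a b : ℂ, dist a b ≤ ρ → b.re - ρ ≤ a.re := by
    intro a b hab
    have h1 := Complex.abs_re_le_norm (a - b)
    rw [dist_eq_norm] at hab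
    have h2 := abs_le.1 (h1.trans hab)
    simp only [Complex.sub_re] at h2
    linarith [h2.1]
  have key := intervalIntegral.hasDerivAt_integral_of_dominated_loc_of_deriv_le
    (μ := MeasureTheory.volume) (a := (0:ℝ)) (b := 2 * Real.pi)
    (F := G) (F' := fun c θ => deriv (fun c => G c θ) c) (x₀ := c₀)
    (s := ball c₀ (ρ / 2)) (bound := fun _ => C / (ρ / 2)) (ball_mem_nhds _ (by positivity))
    ?_ ?_ ?_ ?_ ?_ ?_
  · exact key.2.differentiableAt.differentiableWithinAt
  · filter_upwards [hO.mem_nhds hc₀] with c hcc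
    exact (hc c hcc).aestronglyMeasurable
  · exact (hc c₀ hc₀).intervalIntegrable _ _
  · refine aestronglyMeasurable_of_tendsto_ae (u := (atTop : Filter ℕ))
      (f := fun n θ => (((n:ℂ) + 1)⁻¹)⁻¹ • (G (c₀ + ((n:ℂ) + 1)⁻¹) θ - G c₀ θ)) ?_ ?_
    · intro n
      have : 0 < (c₀ + ((n:ℂ) + 1)⁻¹).re := by
        have e : ((n:ℂ) + 1)⁻¹ = (((n:ℝ) + 1)⁻¹ : ℝ) := by push_cast; rfl
        rw [e, Complex.add_re, Complex.ofReal_re]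
        positivity
      exact (((hc _ this).sub (hc _ hc₀)).const_smul ((((n:ℂ) + 1)⁻¹)⁻¹)).aestronglyMeasurable
    · refine Eventually.of_forall fun θ => ?_
      have h1 : HasDerivAt (fun c => G c θ) (deriv (fun c => G c θ) c₀) c₀ :=
        ((hd θ).differentiableAt (hO.mem_nhds hc₀)).hasDerivAt
      have h2 := hasDerivAt_iff_tendsto_slope_zero.1 h1
      refine h2.comp (tendsto_nhdsWithin_iff.2 ⟨?_, ?_⟩)
      · have h3 := tendsto_one_div_add_atTop_nhds_zero_nat (𝕜 := ℂ)
        simpa using h3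
      · refine Eventually.of_forall fun n => ?_
        simp only [mem_compl_iff, mem_singleton_iff]
        exact inv_ne_zero (Nat.cast_add_one_ne_zero n)
  · refine Eventually.of_forall fun θ _ c hcc => ?_
    have hcl : ∀ w ∈ closedBall c (ρ / 2), 0 < w.re := by
      intro w hw
      have : dist w c₀ ≤ ρ := by
        have := dist_triangle w c c₀
        have h1 := mem_closedBall.1 hw
        have h2 := mem_ball.1 hcc
        linarith
      have := hre _ _ this
      linarith
    refine norm_deriv_le_of_forall_mem_sphere_norm_le (by positivity) ?_ ?_
    · exact DifferentiableOn.diffContOnCl_ball (U := {c : ℂ | 0 < c.re}) (hd θ) hcl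
    · intro z hz
      exact hb z (hcl z (sphere_subset_closedBall hz)) θ
  · exact intervalIntegrable_const
  · refine Eventually.of_forall fun θ _ c hcc => ?_
    refine ((hd θ).differentiableAt (hO.mem_nhds ?_)).hasDerivAt
    have h2 := mem_ball.1 hcc
    have := hre c c₀ (by linarith)
    show 0 < c.re
    linarith

/-- A holomorphic function on a half plane with bounded continuations arbitrarily far to
the left has vanishing derivative. -/
theorem deriv_zero_of_ext (f : ℂ → ℂ) (a C : ℝ) (hf : DifferentiableOn ℂ f {w : ℂ | a < w.re})
    (h : ∀ M : ℝ, ∃ (g : ℂ → ℂ) (B : ℝ), DifferentiableOn ℂ g {w : ℂ | -M < w.re} ∧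
      (∀ w : ℂ, -M < w.re → ‖g w‖ ≤ C) ∧ ∀ w : ℂ, B < w.re → g w = f w) :
    ∀ w : ℂ, a < w.re → deriv f w = 0 := by
  intro w hw
  have hC : 0 ≤ C := by
    obtain ⟨g, B, -, h2, -⟩ := h (1 - w.re)
    exact (norm_nonneg _).trans (h2 w (by linarith))
  have key : ∀ R : ℝ, 0 < R → ‖deriv f w‖ ≤ C / R := by
    intro R hR
    obtain ⟨g, B, hg, hgb, hgf⟩ := h (R + 1 + |a| + |w.re|)
    set M := R + 1 + |a| + |w.re|
    have hMa : -M < a := by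
      have := neg_abs_le a
      have := abs_nonneg w.re
      simp only [M]; linarith
    have hMw : -M < w.re - R := by
      have := neg_abs_le w.re
      have := abs_nonneg a
      simp only [M]; linarith
    have hU := halfPlane_isOpen a
    have hEq : EqOn g f {w : ℂ | a < w.re} := by
      refine AnalyticOnNhd.eqOn_of_preconnected_of_eventuallyEq
        (z₀ := ((max a B + 1 : ℝ) : ℂ)) ?_ (hf.analyticOnNhd hU) ?_ ?_ ?_
      · refine (hg.mono ?_).analyticOnNhd hU
        intro x hx
        exact hMa.trans hx
      · exact (convex_halfSpace_re_gt a).isPreconnected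
      · show a < _
        rw [Complex.ofReal_re]
        linarith [le_max_left a B]
      · filter_upwards [(halfPlane_isOpen B).mem_nhds
          (show B < ((max a B + 1 : ℝ) : ℂ).re by
            rw [Complex.ofReal_re]; linarith [le_max_right a B])] with x hx
        exact hgf x hx
    have hd : deriv f w = deriv g w := by
      apply Filter.EventuallyEq.deriv_eq
      filter_upwards [hU.mem_nhds hw] with x hx
      exact (hEq hx).symm
    rw [hd]
    have hcl : ∀ x ∈ closedBall w R, -M < x.re := by
      intro x hx
      have h1 := Complex.abs_re_le_norm (x - w)
      rw [mem_closedBall, dist_eq_norm] at hx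
      have h2 := abs_le.1 (h1.trans hx)
      simp only [Complex.sub_re] at h2
      linarith [h2.1]
    refine norm_deriv_le_of_forall_mem_sphere_norm_le hR ?_ ?_
    · exact DifferentiableOn.diffContOnCl_ball (U := {c : ℂ | -M < c.re}) hg hcl
    · intro z hz
      exact hgb z (hcl z (sphere_subset_closedBall hz))
  have hlim : Tendsto (fun R : ℝ => C / R) atTop (𝓝 0) := tendsto_const_nhds.div_atTop tendsto_id
  have : ‖deriv f w‖ ≤ 0 := by
    refine ge_of_tendsto hlim ?_
    filter_upwards [eventually_gt_atTop 0] with R hR using key R hR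
  exact norm_le_zero_iff.1 this

/-- Continuation along a family of analytic discs with boundary in the tube. -/
theorem disc_ext (φ : ℝ → ℝ) (hφ : Continuous φ) (F : ℂ × ℂ → ℂ) (C : ℝ)
    (hF : DifferentiableOn ℂ F {z : ℂ × ℂ | φ z.1.re < z.2.re})
    (hC : ∀ z : ℂ × ℂ, φ z.1.re < z.2.re → ‖F z‖ ≤ C)
    (p q : ℂ → ℂ) (hp : ∀ x ∈ closedBall (0:ℂ) 1, DifferentiableAt ℂ p x)
    (hq : ∀ x ∈ closedBall (0:ℂ) 1, DifferentiableAt ℂ q x)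
    (hb : ∀ x : ℂ, ‖x‖ = 1 → φ (p x).re < (q x).re) :
    ∃ (g : ℂ → ℂ) (B : ℝ), DifferentiableOn ℂ g {w : ℂ | 0 < w.re} ∧
      (∀ w : ℂ, 0 < w.re → ‖g w‖ ≤ C) ∧ ∀ w : ℂ, B < w.re → g w = F (p 0, q 0 + w) := by
  have hT : IsOpen {z : ℂ × ℂ | φ z.1.re < z.2.re} :=
    isOpen_lt (by fun_prop) (by fun_prop)
  have hcp : ContinuousOn p (closedBall (0:ℂ) 1) := fun x hx => (hp x hx).continuousAt.continuousWithinAt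
  have hcq : ContinuousOn q (closedBall (0:ℂ) 1) := fun x hx => (hq x hx).continuousAt.continuousWithinAt
  have hcont : ContinuousOn (fun x => φ (p x).re - (q x).re) (closedBall (0:ℂ) 1) :=
    (hφ.comp_continuousOn (Complex.continuous_re.comp_continuousOn hcp)).sub
      (Complex.continuous_re.comp_continuousOn hcq)
  obtain ⟨B, hB⟩ := (isCompact_closedBall (0:ℂ) 1).bddAbove_image hcont
  have hB' : ∀ x ∈ closedBall (0:ℂ) 1, φ (p x).re - (q x).re ≤ B :=
    fun x hx => hB (mem_image_of_mem _ hx)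
  have hcm : ∀ θ : ℝ, ‖circleMap 0 1 θ‖ = 1 := by intro θ; simp
  have hcm' : ∀ θ : ℝ, circleMap 0 1 θ ∈ closedBall (0:ℂ) 1 := by intro θ; simp
  have hmem : ∀ c : ℂ, 0 < c.re → ∀ θ : ℝ,
      φ (p (circleMap 0 1 θ)).re < (q (circleMap 0 1 θ) + c).re := by
    intro c hc θ
    have := hb _ (hcm θ)
    rw [Complex.add_re]
    linarith
  refine ⟨fun c => Real.circleAverage (fun x => F (p x, q x + c)) 0 1, B, ?_, ?_, ?_⟩
  · simp only [Real.circleAverage_def]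
    refine DifferentiableOn.const_smul ?_ _
    refine avg_diff (fun c θ => F (p (circleMap 0 1 θ), q (circleMap 0 1 θ) + c)) C ?_ ?_ ?_
    · intro c hc
      refine hF.continuousOn.comp_continuous ?_ (fun θ => hmem c hc θ)
      have h1 : Continuous fun θ => p (circleMap 0 1 θ) :=
        hcp.comp_continuous (continuous_circleMap 0 1) hcm'
      have h2 : Continuous fun θ => q (circleMap 0 1 θ) :=
        hcq.comp_continuous (continuous_circleMap 0 1) hcm'
      exact h1.prodMk (h2.add continuous_const)
    · intro θ
      refine hF.comp (f := fun c => (p (circleMap 0 1 θ), q (circleMap 0 1 θ) + c)) ?_ ?_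
      · fun_prop
      · intro c hc
        exact hmem c hc θ
    · intro c hc θ
      exact hC _ (hmem c hc θ)
  · intro c hc
    simp only [Real.circleAverage_def, norm_smul]
    have h := intervalIntegral.norm_integral_le_of_norm_le_const (a := 0) (b := 2 * Real.pi)
      (f := fun θ => F (p (circleMap 0 1 θ), q (circleMap 0 1 θ) + c)) (C := C)
      (fun θ _ => hC _ (hmem c hc θ))
    have hpi := Real.pi_pos
    rw [sub_zero, abs_of_pos (by positivity)] at h
    rw [Real.norm_of_nonneg (by positivity)]
    calc _ ≤ (2 * Real.pi)⁻¹ * (C * (2 * Real.pi)) := by gcongr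
      _ = C := by field_simp
  · intro c hc
    have hd : ∀ x ∈ closedBall (0:ℂ) 1, DifferentiableAt ℂ (fun x => F (p x, q x + c)) x := by
      intro x hx
      have hx' : φ (p x).re < (q x + c).re := by
        have := hB' x hx
        rw [Complex.add_re]
        linarith
      have h1 : DifferentiableAt ℂ F (p x, q x + c) := hF.differentiableAt (hT.mem_nhds hx')
      exact DifferentiableAt.comp (f := fun x => (p x, q x + c)) x h1
        ((hp x hx).prodMk ((hq x hx).add_const c))
    refine DiffContOnCl.circleAverage (f := fun x => F (p x, q x + c)) (c := 0) (R := 1) ?_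
    rw [abs_one]
    refine DifferentiableOn.diffContOnCl_ball (U := closedBall 0 1) ?_ subset_rfl
    exact fun x hx => (hd x hx).differentiableWithinAt

/-- Properties of the Cayley transform on the unit circle. -/
theorem cayley_facts (r : ℝ) (hr0 : 0 ≤ r) (hr1 : r < 1) (x : ℂ) (hx : ‖x‖ = 1) :
    0 ≤ ((1 + r * x) / (1 - r * x)).re ∧
    ((1 + r * x) / (1 - r * x)).re ≤ (1 + r) / (1 - r) ∧
    (((1 + r * x) / (1 - r * x)) ^ 2 +
      (((1 + r) / (1 - r) + (1 - r) / (1 + r) : ℝ) : ℂ) * ((1 + r * x) / (1 - r * x)) - 1).re =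
      2 * ((1 + r * x) / (1 - r * x)).re ^ 2 := by
  obtain ⟨a, b⟩ := x
  have hab : a * a + b * b = 1 := by
    have : ‖(⟨a, b⟩ : ℂ)‖ ^ 2 = 1 := by rw [hx]; norm_num
    rw [← Complex.normSq_eq_norm_sq, Complex.normSq_mk] at this
    exact this
  have ha : a ≤ 1 := by nlinarith [mul_self_nonneg b]
  have hden : 0 < 1 - 2 * r * a + r ^ 2 := by nlinarith
  have e : (1 + r * (⟨a, b⟩ : ℂ)) / (1 - r * (⟨a, b⟩ : ℂ)) =
      ⟨(1 - r ^ 2) / (1 - 2 * r * a + r ^ 2), 2 * r * b / (1 - 2 * r * a + r ^ 2)⟩ := by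
    have hne : (1 - r * (⟨a, b⟩ : ℂ)) ≠ 0 := by
      intro h
      have h1 := congrArg Complex.re h
      simp at h1
      nlinarith
    rw [div_eq_iff hne]
    have hd := hden.ne'
    apply Complex.ext
    · simp only [Complex.add_re, Complex.sub_re, Complex.mul_re, Complex.mul_im, Complex.one_re,
        Complex.sub_im, Complex.one_im, Complex.ofReal_re, Complex.ofReal_im]
      rw [div_mul_eq_mul_div, div_mul_eq_mul_div, div_sub_div_same, eq_div_iff hd]
      linear_combination (-2 * r ^ 2) * hab
    · simp only [Complex.add_im, Complex.sub_re, Complex.mul_re, Complex.mul_im, Complex.one_re,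
        Complex.sub_im, Complex.one_im, Complex.ofReal_re, Complex.ofReal_im]
      rw [div_mul_eq_mul_div, div_mul_eq_mul_div, ← add_div, eq_div_iff hd]
      ring
  rw [e]
  have h1 : 0 < 1 - r := by linarith
  refine ⟨?_, ?_, ?_⟩
  · simp only
    apply div_nonneg _ hden.le
    nlinarith
  · simp only
    rw [div_le_div_iff₀ hden h1]
    nlinarith [mul_nonneg hr0 (sub_nonneg.2 ha)]
  · have h2 : (1 + r) ≠ 0 := by positivity
    have hd := hden.ne'
    have hK : ∃ K : ℝ, K = (1 + r) / (1 - r) + (1 - r) / (1 + r) := ⟨_, rfl⟩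
    obtain ⟨K, hK⟩ := hK
    rw [← hK]
    have hK2 : K * (1 - r ^ 2) = 2 + 2 * r ^ 2 := by
      have h3 := h1.ne'
      rw [hK]
      field_simp
      ring
    rw [pow_two, Complex.sub_re, Complex.add_re, Complex.mul_re, Complex.re_ofReal_mul,
      Complex.one_re]
    simp only
    obtain ⟨d, hdd⟩ : ∃ d : ℝ, d = 1 - 2 * r * a + r ^ 2 := ⟨_, rfl⟩
    rw [← hdd] at hd ⊢
    field_simp
    linear_combination (-4 * r ^ 2) * hab + d * hK2 + (1 + 2 * r * a + r ^ 2 - d) * hdd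

theorem tendsto_aux (y σ β M : ℝ) (hσ : 0 < σ) (hβ : 1 < β) :
    ∃ D : ℝ, 1 < D ∧ y - σ * D ^ (β - 1) < M := by
  have h1 : Tendsto (fun D : ℝ => D ^ (β - 1)) atTop atTop := tendsto_rpow_atTop (by linarith)
  obtain ⟨D, hD, hD1⟩ := ((h1.eventually_gt_atTop ((y - M) / σ)).and (eventually_gt_atTop 1)).exists
  refine ⟨D, hD1, ?_⟩
  rw [div_lt_iff₀ hσ] at hD
  linarith

def Growth (φ : ℝ → ℝ) : Prop :=
  ∀ x : ℝ, ∃ δ y σ β : ℝ, 0 < δ ∧ 0 < σ ∧ 1 < β ∧ β ≤ 2 ∧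
    ∀ P : ℝ, 0 ≤ P → φ (x + δ - δ * P) < y - σ * P ^ β

theorem slice_ext (φ : ℝ → ℝ) (hφ : Continuous φ) (hG : Growth φ) (F : ℂ × ℂ → ℂ) (C : ℝ)
    (hF : DifferentiableOn ℂ F {z : ℂ × ℂ | φ z.1.re < z.2.re})
    (hC : ∀ z : ℂ × ℂ, φ z.1.re < z.2.re → ‖F z‖ ≤ C) (z : ℂ) (M : ℝ) :
    ∃ (g : ℂ → ℂ) (B : ℝ), DifferentiableOn ℂ g {w : ℂ | -M < w.re} ∧
      (∀ w : ℂ, -M < w.re → ‖g w‖ ≤ C) ∧ ∀ w : ℂ, B < w.re → g w = F (z, w) := by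
  obtain ⟨δ, y, σ, β, hδ, hσ, hβ1, hβ2, hgr⟩ := hG z.re
  obtain ⟨D, hD1, hD⟩ := tendsto_aux y (σ / 2) β (-M) (by positivity) hβ1
  have hD0 : 0 < D := by linarith
  set r : ℝ := (D - 1) / (D + 1) with hr
  have hr0 : 0 ≤ r := div_nonneg (by linarith) (by linarith)
  have hr1 : r < 1 := by rw [hr, div_lt_one (by linarith)]; linarith
  have hrD : (1 + r) / (1 - r) = D := by
    rw [div_eq_iff (by linarith), hr]
    field_simp
    ring
  have hrD' : (1 - r) / (1 + r) = D⁻¹ := by rw [← hrD, inv_div]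
  let W : ℂ → ℂ := fun x => (1 + r * x) / (1 - r * x)
  let κ : ℝ := σ * D ^ (β - 2) / 2
  let p : ℂ → ℂ := fun x => z + δ - δ * W x
  let q : ℂ → ℂ := fun x => y - (κ : ℂ) * (W x ^ 2 + ((D + D⁻¹ : ℝ) : ℂ) * W x - 1)
  have hW : ∀ x ∈ closedBall (0:ℂ) 1, DifferentiableAt ℂ W x := by
    intro x hx
    have hx' : ‖x‖ ≤ 1 := by simpa using hx
    have hne : (1 - r * x) ≠ 0 := by
      intro h
      have h1 : (1:ℂ) = r * x := sub_eq_zero.1 h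
      have h2 := congrArg norm h1
      rw [norm_mul, Complex.norm_real, norm_one, Real.norm_of_nonneg hr0] at h2
      nlinarith
    exact DifferentiableAt.div (by fun_prop) (by fun_prop) hne
  have hp : ∀ x ∈ closedBall (0:ℂ) 1, DifferentiableAt ℂ p x := by
    intro x hx
    have := hW x hx
    simp only [p]
    fun_prop
  have hq : ∀ x ∈ closedBall (0:ℂ) 1, DifferentiableAt ℂ q x := by
    intro x hx
    have := hW x hx
    simp only [q]
    fun_prop
  have hb : ∀ x : ℂ, ‖x‖ = 1 → φ (p x).re < (q x).re := by
    intro x hx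
    obtain ⟨h1, h2, h3⟩ := cayley_facts r hr0 hr1 x hx
    rw [hrD] at h2
    rw [hrD, hrD'] at h3
    change 0 ≤ (W x).re at h1
    change (W x).re ≤ D at h2
    change (W x ^ 2 + ((D + D⁻¹ : ℝ) : ℂ) * W x - 1).re = 2 * (W x).re ^ 2 at h3
    have e1 : (p x).re = z.re + δ - δ * (W x).re := by simp [p]
    have e2 : (q x).re = y - κ * (2 * (W x).re ^ 2) := by
      rw [← h3]
      simp only [q, Complex.sub_re, Complex.re_ofReal_mul, Complex.ofReal_re]
    rw [e1, e2]
    refine (hgr _ h1).trans_le ?_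
    have h4 : D ^ (β - 2) * (W x).re ^ 2 ≤ (W x).re ^ β := by
      rcases h1.eq_or_lt with h0 | h0
      · rw [← h0, Real.zero_rpow (by linarith)]; simp
      · have : (W x).re ^ β = (W x).re ^ (β - 2) * (W x).re ^ 2 := by
          rw [← Real.rpow_natCast, ← Real.rpow_add h0]
          norm_num
        rw [this]
        have := Real.rpow_le_rpow_of_nonpos h0 h2 (show β - 2 ≤ 0 by linarith)
        gcongr
    have := mul_le_mul_of_nonneg_left h4 hσ.le
    simp only [κ]
    linarith
  obtain ⟨g, B, g1, g2, g3⟩ := disc_ext φ hφ F C hF hC p q hp hq hb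
  have hp0 : p 0 = z := by simp [p, W]
  have hq0 : q 0 = ((y - κ * (D + D⁻¹) : ℝ) : ℂ) := by simp [q, W]
  have hm : y - κ * (D + D⁻¹) < -M := by
    refine lt_of_le_of_lt ?_ hD
    have e : D ^ (β - 1) = D ^ (β - 2) * D := by
      rw [← Real.rpow_add_one hD0.ne']; congr 1; ring
    have h5 : 0 ≤ κ * D⁻¹ := by positivity
    have : κ * D = σ / 2 * D ^ (β - 1) := by rw [e]; simp only [κ]; ring
    linarith
  set m : ℝ := y - κ * (D + D⁻¹)
  refine ⟨fun w => g (w - m), B + m, ?_, ?_, ?_⟩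
  · refine g1.comp (f := fun w => w - (m:ℂ)) (by fun_prop) ?_
    intro w hw
    have hw' : -M < w.re := hw
    simp only [mem_ofPred_eq, Complex.sub_re, Complex.ofReal_re]
    linarith
  · intro w hw
    apply g2
    simp only [Complex.sub_re, Complex.ofReal_re]
    linarith
  · intro w hw
    simp only
    rw [g3 _ (by simp only [Complex.sub_re, Complex.ofReal_re]; linarith), hp0, hq0]
    simp

theorem liouville_core (φ : ℝ → ℝ) (hφ : Continuous φ) (hG : Growth φ) (F : ℂ × ℂ → ℂ) (C : ℝ)
    (hF : DifferentiableOn ℂ F {z : ℂ × ℂ | φ z.1.re < z.2.re})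
    (hC : ∀ z : ℂ × ℂ, φ z.1.re < z.2.re → ‖F z‖ ≤ C) (z w : ℂ × ℂ)
    (hz : φ z.1.re < z.2.re) (hw : φ w.1.re < w.2.re) : F z = F w := by
  have hT : IsOpen {z : ℂ × ℂ | φ z.1.re < z.2.re} :=
    isOpen_lt (by fun_prop) (by fun_prop)
  have hslice : ∀ a u v : ℂ, φ a.re < u.re → φ a.re < v.re → F (a, u) = F (a, v) := by
    intro a u v hu hv
    have hd : DifferentiableOn ℂ (fun u => F (a, u)) {u : ℂ | φ a.re < u.re} :=
      hF.comp (f := fun u => (a, u)) (by fun_prop) (fun u hu => hu)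
    have h0 := deriv_zero_of_ext (fun u => F (a, u)) (φ a.re) C hd
      (slice_ext φ hφ hG F C hF hC a)
    exact (halfPlane_isOpen (φ a.re)).is_const_of_deriv_eq_zero
      (convex_halfSpace_re_gt _).isPreconnected hd (fun u hu => h0 u hu) hu hv
  let h : ℂ → ℂ := fun a => F (a, ((φ a.re + 1 : ℝ) : ℂ))
  have hmem : ∀ a : ℂ, φ a.re < (((φ a.re + 1 : ℝ) : ℂ)).re := by
    intro a; rw [Complex.ofReal_re]; linarith
  have hdiff : Differentiable ℂ h := by
    intro a
    have h1 : DifferentiableAt ℂ (fun b => F (b, ((φ a.re + 1 : ℝ) : ℂ))) a :=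
      DifferentiableAt.comp (f := fun b : ℂ => (b, ((φ a.re + 1 : ℝ) : ℂ))) a
        (hF.differentiableAt (hT.mem_nhds (hmem a))) (by fun_prop)
    refine h1.congr_of_eventuallyEq ?_
    have hO : IsOpen {b : ℂ | φ b.re < φ a.re + 1} := isOpen_lt (by fun_prop) (by fun_prop)
    filter_upwards [hO.mem_nhds (show φ a.re < φ a.re + 1 by linarith)] with b hb
    exact hslice b _ _ (hmem b) (by rw [Complex.ofReal_re]; exact hb)
  have hbd : Bornology.IsBounded (range h) := by
    rw [isBounded_iff_forall_norm_le]
    refine ⟨C, ?_⟩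
    rintro _ ⟨a, rfl⟩
    exact hC _ (hmem a)
  have e := hdiff.apply_eq_apply_of_bounded hbd z.1 w.1
  have e1 : F z = h z.1 := hslice z.1 z.2 _ hz (hmem _)
  have e2 : F w = h w.1 := hslice w.1 w.2 _ hw (hmem _)
  rw [e1, e2, e]

theorem hull_core (φ : ℝ → ℝ) (hG : Growth φ) :
    convexHull ℝ {x : ℝ × ℝ | φ x.1 < x.2} = univ := by
  refine eq_univ_of_forall fun x => ?_
  obtain ⟨δ, y, σ, β, hδ, hσ, hβ1, hβ2, hgr⟩ := hG x.1
  obtain ⟨D, hD1, hD⟩ := tendsto_aux y σ β x.2 hσ hβ1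
  have hD0 : 0 < D := by linarith
  have h0 := hgr 0 le_rfl
  have h1 := hgr D hD0.le
  rw [Real.zero_rpow (by linarith)] at h0
  set e : ℝ := x.2 - (y - σ * D ^ (β - 1)) with he
  have m0 : (x.1 + δ - δ * 0, y + e) ∈ {x : ℝ × ℝ | φ x.1 < x.2} := by
    show φ (x.1 + δ - δ * 0) < y + e
    linarith
  have m1 : (x.1 + δ - δ * D, y - σ * D ^ β + e) ∈ {x : ℝ × ℝ | φ x.1 < x.2} := by
    show φ (x.1 + δ - δ * D) < y - σ * D ^ β + e
    linarith
  have hc := (convex_convexHull ℝ {x : ℝ × ℝ | φ x.1 < x.2}) (subset_convexHull ℝ _ m0)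
    (subset_convexHull ℝ _ m1) (a := 1 - D⁻¹) (b := D⁻¹)
    (sub_nonneg.2 (inv_le_one_of_one_le₀ hD1.le)) (by positivity) (by ring)
  have hpow : D ^ β = D ^ (β - 1) * D := by
    rw [← Real.rpow_add_one hD0.ne']; congr 1; ring
  convert hc using 1
  ext
  · simp only [Prod.smul_mk, Prod.mk_add_mk, smul_eq_mul]
    field_simp
    ring
  · simp only [Prod.smul_mk, Prod.mk_add_mk, smul_eq_mul, hpow, he]
    field_simp
    ring

theorem growth_phi (α s t : ℝ) (hα : 1 < α) (hs : s < 0) (ht : 0 < t) :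
    Growth (fun x => t * max x 0 ^ α + s * max (-x) 0 ^ α) := by
  intro x
  set b : ℝ := |x| + 1 with hb
  have hb1 : 1 ≤ b := by simp [hb]
  have hβ1 : 1 < min α 2 := lt_min hα (by norm_num)
  set β := min α 2 with hβ
  have hδ : 1 ≤ b - x := by linarith [le_abs_self x]
  set δ := b - x with hδd
  set σ := -s * (1/2) ^ β with hσd
  have hσ : 0 < σ := mul_pos (by linarith) (by positivity)
  refine ⟨δ, t * b ^ α + σ * (2 * b) ^ β + 1, σ, β, by linarith, hσ, hβ1, min_le_right _ _, ?_⟩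
  intro P hP
  have e : x + δ - δ * P = b - δ * P := by simp only [hδd]; ring
  rw [e]
  have hδP : 0 ≤ δ * P := by positivity
  have hPδ : P ≤ δ * P := by nlinarith
  simp only
  rcases le_or_gt (δ * P) (2 * b) with h | h
  · have h1 : max (b - δ * P) 0 ^ α ≤ b ^ α :=
      Real.rpow_le_rpow (le_max_right _ _) (max_le (by linarith) (by linarith)) (by linarith)
    have h2 : 0 ≤ max (-(b - δ * P)) 0 ^ α := Real.rpow_nonneg (le_max_right _ _) _
    have h3 : P ^ β ≤ (2 * b) ^ β := Real.rpow_le_rpow hP (by linarith) (by linarith)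
    nlinarith [mul_le_mul_of_nonneg_left h1 ht.le, mul_le_mul_of_nonneg_left h3 hσ.le]
  · rw [max_eq_right (show b - δ * P ≤ 0 by linarith), max_eq_left (show 0 ≤ -(b - δ * P) by linarith),
      Real.zero_rpow (by linarith)]
    have h1 : (1/2 * P) ^ β ≤ (-(b - δ * P)) ^ β :=
      Real.rpow_le_rpow (by positivity) (by linarith) (by linarith)
    have h2 : (-(b - δ * P)) ^ β ≤ (-(b - δ * P)) ^ α :=
      Real.rpow_le_rpow_of_exponent_le (by linarith) (min_le_left _ _)
    rw [Real.mul_rpow (by norm_num) hP] at h1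
    have h3 := mul_le_mul_of_nonneg_left (h1.trans h2) (show 0 ≤ -s by linarith)
    have h4 : 0 ≤ t * b ^ α := by positivity
    have h5 : 0 ≤ σ * (2 * b) ^ β := by positivity
    simp only [hσd] at h5 ⊢
    linarith

theorem setA_eq (α s t : ℝ) (hα : 0 < α) :
    setA α s t = {x : ℝ × ℝ | t * max x.1 0 ^ α + s * max (-x.1) 0 ^ α < x.2} := by
  ext ⟨a, b⟩
  show ((0 < a → t * a ^ α < b) ∧ (a = 0 → 0 < b) ∧ (a < 0 → s * (-a) ^ α < b)) ↔
    t * max a 0 ^ α + s * max (-a) 0 ^ α < b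
  rcases lt_trichotomy a 0 with h | h | h
  · rw [max_eq_right h.le, max_eq_left (by linarith), Real.zero_rpow hα.ne']
    simp [h, h.ne, h.le]
  · subst h
    simp [Real.zero_rpow hα.ne']
  · rw [max_eq_left h.le, max_eq_right (by linarith), Real.zero_rpow hα.ne']
    simp [h, h.ne', h.le]

theorem main_gt (α s t : ℝ) (hα : 1 < α) (hs : s < 0) (ht : 0 < t) :
    convexHull ℝ (setA α s t) = Set.univ ∧
    ∀ F : ℂ × ℂ → ℂ, DifferentiableOn ℂ F (tube (setA α s t)) →
      (∃ C : ℝ, ∀ z ∈ tube (setA α s t), ‖F z‖ ≤ C) →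
      ∀ z ∈ tube (setA α s t), ∀ w ∈ tube (setA α s t), F z = F w := by
  have hα0 : 0 < α := by linarith
  have hG := growth_phi α s t hα hs ht
  have hφ : Continuous (fun x : ℝ => t * max x 0 ^ α + s * max (-x) 0 ^ α) := by
    have h1 : Continuous (fun x : ℝ => max x 0 ^ α) :=
      Continuous.rpow_const (by fun_prop) (fun _ => Or.inr hα0.le)
    have h2 : Continuous (fun x : ℝ => max (-x) 0 ^ α) :=
      Continuous.rpow_const (by fun_prop) (fun _ => Or.inr hα0.le)
    fun_prop
  rw [setA_eq α s t hα0]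
  refine ⟨hull_core _ hG, ?_⟩
  rintro F hF ⟨C, hC⟩ z hz w hw
  exact liouville_core _ hφ hG F C hF hC z w hz hw

/-- One half of the reflection symmetry. -/
theorem rpow_swap (α t a b : ℝ) (hα : 0 < α) (ht : 0 < t) (ha : 0 ≤ a) (hb : 0 ≤ b) :
    t * a ^ α < b ↔ a < t ^ (-α⁻¹) * b ^ α⁻¹ := by
  rw [Real.rpow_neg ht.le, ← Real.inv_rpow ht.le, ← Real.mul_rpow (by positivity) hb,
    Real.lt_rpow_inv_iff_of_pos ha (by positivity) hα, inv_mul_eq_div, lt_div_iff₀ ht, mul_comm]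

theorem rpow_swap' (α t a b : ℝ) (hα : 0 < α) (ht : 0 < t) (ha : 0 ≤ a) (hb : 0 ≤ b) :
    b < t * a ^ α ↔ t ^ (-α⁻¹) * b ^ α⁻¹ < a := by
  rw [Real.rpow_neg ht.le, ← Real.inv_rpow ht.le, ← Real.mul_rpow (by positivity) hb,
    Real.rpow_inv_lt_iff_of_pos (by positivity) ha hα, inv_mul_eq_div, div_lt_iff₀ ht, mul_comm]

theorem setA_swap (α s t : ℝ) (hα : 0 < α) (hs : s < 0) (ht : 0 < t) (a b : ℝ) :
    (a, b) ∈ setA α s t ↔ (-b, -a) ∈ setA α⁻¹ (-t ^ (-α⁻¹)) ((-s) ^ (-α⁻¹)) := by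
  show ((0 < a → t * a ^ α < b) ∧ (a = 0 → 0 < b) ∧ (a < 0 → s * (-a) ^ α < b)) ↔
    ((0 < -b → (-s) ^ (-α⁻¹) * (-b) ^ α⁻¹ < -a) ∧ (-b = 0 → 0 < -a) ∧
      (-b < 0 → -t ^ (-α⁻¹) * (- -b) ^ α⁻¹ < -a))
  have ht' : 0 < t ^ (-α⁻¹) := by positivity
  have hs' : 0 < (-s) ^ (-α⁻¹) := Real.rpow_pos_of_pos (by linarith) _
  rw [neg_neg]
  rcases lt_trichotomy a 0 with h | h | h
  · have l : 0 < s * (-a) ^ α ↔ False := by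
      have := Real.rpow_pos_of_pos (neg_pos.2 h) α
      simp only [iff_false, not_lt]
      nlinarith
    rcases lt_trichotomy b 0 with h' | h' | h'
    · have := rpow_swap' α (-s) (-a) (-b) hα (by linarith) (by linarith) (by linarith)
      simp only [h, h.ne, h.not_gt, h', h'.ne, h'.not_gt, neg_pos, neg_eq_zero, neg_lt_zero,
        forall_true_left, false_imp_iff, true_and, and_true]
      rw [← this]
      constructor <;> intro <;> linarith
    · subst h'
      have := Real.rpow_pos_of_pos (neg_pos.2 h) α
      simp [h, h.ne, h.not_gt]
      nlinarith
    · have h1 := Real.rpow_pos_of_pos (neg_pos.2 h) α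
      have h2 := Real.rpow_pos_of_pos h' α⁻¹
      have h3 : s * (-a) ^ α < b := by nlinarith
      have h4 : -t ^ (-α⁻¹) * b ^ α⁻¹ < -a := by nlinarith
      simp [h.ne, h.not_gt, h'.ne', h'.not_gt, h3]
      intro; linarith
  · subst h
    rcases lt_trichotomy b 0 with h' | h' | h'
    · have h2 := Real.rpow_pos_of_pos (neg_pos.2 h') α⁻¹
      have h3 : 0 < (-s) ^ (-α⁻¹) * (-b) ^ α⁻¹ := by positivity
      simp [h', h'.ne, h'.not_gt]
      exact h3.le
    · subst h'; simp
    · have h2 := Real.rpow_pos_of_pos h' α⁻¹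
      have h3 : 0 < t ^ (-α⁻¹) * b ^ α⁻¹ := by positivity
      simp [h', h'.ne', h'.not_gt]
      exact h3
  · rcases lt_trichotomy b 0 with h' | h' | h'
    · have h2 := Real.rpow_pos_of_pos (neg_pos.2 h') α⁻¹
      have h3 : 0 < (-s) ^ (-α⁻¹) * (-b) ^ α⁻¹ := by positivity
      have h1 : 0 < t * a ^ α := by positivity
      have n1 : ¬ t * a ^ α < b := by linarith
      have n2 : ¬ (-s) ^ (-α⁻¹) * (-b) ^ α⁻¹ < -a := by linarith
      simp only [h, n1, n2, neg_pos, h', forall_true_left, false_and]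
    · subst h'
      have h1 : 0 < t * a ^ α := by positivity
      have n1 : ¬ t * a ^ α < 0 := by linarith
      have n2 : ¬ (0 < -a) := by linarith
      simp only [h, n1, n2, neg_zero, forall_true_left, false_and, and_false]
    · have := rpow_swap α t a b hα ht h.le h'.le
      simp only [h, h.ne', h.not_gt, h', h'.ne', h'.not_gt, neg_pos, neg_eq_zero, neg_lt_zero,
        forall_true_left, false_imp_iff, true_and, and_true]
      rw [this]
      constructor <;> intro <;> linarith

/-- The convex hull of `A_{α,s,t}` is all of `ℝ²`; consequently every bounded
holomorphic function on the tube domain `T_{A_{α,s,t}}` is constant. -/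
theorem convexHull_setA_eq_univ_and_liouville (α s t : ℝ) (hα : 0 < α) (hα1 : α ≠ 1)
    (hs : s < 0) (ht : 0 < t) :
    convexHull ℝ (setA α s t) = Set.univ ∧
    ∀ F : ℂ × ℂ → ℂ, DifferentiableOn ℂ F (tube (setA α s t)) →
      (∃ C : ℝ, ∀ z ∈ tube (setA α s t), ‖F z‖ ≤ C) →
      ∀ z ∈ tube (setA α s t), ∀ w ∈ tube (setA α s t), F z = F w := by
  rcases lt_or_gt_of_ne hα1 with h | h
  swap
  · exact main_gt α s t h hs ht
  have ht' : 0 < t ^ (-α⁻¹) := by positivity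
  have hs' : 0 < (-s) ^ (-α⁻¹) := Real.rpow_pos_of_pos (by linarith) _
  obtain ⟨h1, h2⟩ := main_gt α⁻¹ (-t ^ (-α⁻¹)) ((-s) ^ (-α⁻¹)) ((one_lt_inv₀ hα).2 h)
    (by linarith) hs'
  have hsw := setA_swap α s t hα hs ht
  set A' := setA α⁻¹ (-t ^ (-α⁻¹)) ((-s) ^ (-α⁻¹))
  have hmem : ∀ z : ℂ × ℂ, z ∈ tube (setA α s t) ↔ (-z.2, -z.1) ∈ tube A' := by
    intro z
    exact hsw z.1.re z.2.re
  have hmem' : ∀ z : ℂ × ℂ, z ∈ tube A' → (-z.2, -z.1) ∈ tube (setA α s t) := by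
    intro z hz
    rw [hmem]
    simpa using hz
  constructor
  · have hL : IsLinearMap ℝ (fun x : ℝ × ℝ => (-x.2, -x.1)) :=
      { map_add := by intro x y; ext <;> simp <;> ring
        map_smul := by intro c x; ext <;> simp }
    have himg : Set.image (fun x : ℝ × ℝ => (-x.2, -x.1)) A' = setA α s t := by
      ext ⟨a, b⟩
      rw [hsw]
      constructor
      · rintro ⟨⟨u, v⟩, hu, he⟩
        simp only [Prod.mk.injEq] at he
        obtain ⟨rfl, rfl⟩ := he
        simpa using hu
      · intro hu
        exact ⟨_, hu, by simp⟩
    rw [← himg, ← hL.image_convexHull, h1, image_univ]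
    refine range_eq_univ.2 fun x => ⟨(-x.2, -x.1), by simp⟩
  · rintro F hF ⟨C, hC⟩ z hz w hw
    have := h2 (fun z => F (-z.2, -z.1))
      (hF.comp (f := fun z : ℂ × ℂ => (-z.2, -z.1)) (by fun_prop) (fun z hz => hmem' z hz))
      ⟨C, fun z hz => hC _ (hmem' z hz)⟩ _ ((hmem z).1 hz) _ ((hmem w).1 hw)
    simpa using this
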